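/- In the setting of the Newton method with Armijo line search for minimizing ψ (with V_ℓ ∈ T(ξ_ℓ) and d_ℓ solving V_ℓ d_ℓ = −∇ψ(ξ_ℓ)), suppose that prox_{φ/c} is semismooth at the point Eξ* + λ/c, where ξ* is the unique global minimizer of ψ. Then the unit step size is eventually accepted: there exists ℓ₀ such that the Armijo rule selects τ_ℓ = 1 for all ℓ ≥ ℓ₀. -/

import Mathlib

noncomputable section

open Filter Set Topology
open scoped RealInnerProductSpace

/-- Euclidean space `ℝⁿ`. -/
abbrev En (n : ℕ) : Type := EuclideanSpace ℝ (Fin n)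

/-- `φ` is a proper, lower semicontinuous (closed), convex extended-real-valued
function. -/
def ProperLscConvex {V : Type*} [NormedAddCommGroup V] [NormedSpace ℝ V]
    (φ : V → EReal) : Prop :=
  (∀ z, φ z ≠ ⊥) ∧ (∃ z, φ z ≠ ⊤) ∧ LowerSemicontinuous φ ∧
    ∀ z w : V, ∀ a b : ℝ, 0 ≤ a → 0 ≤ b → a + b = 1 →
      φ (a • z + b • w) ≤ (a : EReal) * φ z + (b : EReal) * φ w

/-- The convex (Fenchel) conjugate `φ*`. -/
def econj {m : ℕ} (φ : En m → EReal) : En m → EReal :=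
  fun y => ⨆ z : En m, (⟪y, z⟫ : EReal) - φ z

/-- The effective domain of an extended-real-valued function. -/
def edom {V : Type*} (g : V → EReal) : Set V := {z | g z ≠ ⊤}

/-- `p` is the proximal operator `prox_{φ/c}`: for every `z`, `p z` is the unique
minimizer of `u ↦ φ(u) + (c/2)‖u - z‖²`. -/
def IsProx {m : ℕ} (φ : En m → EReal) (c : ℝ) (p : En m → En m) : Prop :=
  ∀ z : En m,
    (∀ u : En m,
      φ (p z) + ((c / 2 * ‖p z - z‖ ^ 2 : ℝ) : EReal)
        ≤ φ u + ((c / 2 * ‖u - z‖ ^ 2 : ℝ) : EReal)) ∧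
    ∀ u : En m,
      (∀ v : En m,
        φ u + ((c / 2 * ‖u - z‖ ^ 2 : ℝ) : EReal)
          ≤ φ v + ((c / 2 * ‖v - z‖ ^ 2 : ℝ) : EReal)) → u = p z

/-- The Moreau envelope `φ_c` (expressed through the proximal operator `p`). -/
def menv {m : ℕ} (φ : En m → EReal) (c : ℝ) (p : En m → En m) (z : En m) : ℝ :=
  (φ (p z)).toReal + c / 2 * ‖p z - z‖ ^ 2

/-- The Moreau envelope as an extended-real-valued infimum. -/
def menvE {m : ℕ} (φ : En m → EReal) (c : ℝ) (z : En m) : EReal :=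
  ⨅ u : En m, φ u + ((c / 2 * ‖u - z‖ ^ 2 : ℝ) : EReal)

/-- The augmented Lagrangian `L_c(x,λ) = f(x) + φ_c(Ex + λ/c) - ‖λ‖²/(2c)`. -/
def AL {n m : ℕ} (f : En n → ℝ) (φ : En m → EReal) (c : ℝ) (p : En m → En m)
    (E : En n →L[ℝ] En m) (x : En n) (lam : En m) : ℝ :=
  f x + menv φ c p (E x + c⁻¹ • lam) - ‖lam‖ ^ 2 / (2 * c)

/-- The ordinary Lagrangian `L(x,λ) = f(x) - φ*(λ) + ⟨λ, Ex⟩`. -/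
def Lag {n m : ℕ} (f : En n → ℝ) (φ : En m → EReal) (E : En n →L[ℝ] En m)
    (x : En n) (lam : En m) : EReal :=
  ((f x + ⟪lam, E x⟫ : ℝ) : EReal) - econj φ lam

/-- The primal objective of problem (P). -/
def Pv {n m : ℕ} (f : En n → ℝ) (φ : En m → EReal) (E : En n →L[ℝ] En m)
    (x : En n) : EReal :=
  ((f x : ℝ) : EReal) + φ (E x)

/-- The dual objective of problem (D): `-f*(-Eᵀλ) - φ*(λ)`. -/
def Dv {n m : ℕ} (f : En n → ℝ) (φ : En m → EReal) (E : En n →L[ℝ] En m)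
    (lam : En m) : EReal :=
  - (econj (fun x : En n => ((f x : ℝ) : EReal)) (-(ContinuousLinearMap.adjoint E lam))
      + econj φ lam)

/-- Saddle point of an extended-real-valued Lagrangian. -/
def IsSaddle {n m : ℕ} (L : En n → En m → EReal) (xb : En n) (lb : En m) : Prop :=
  ∀ (x : En n) (lam : En m), L xb lam ≤ L xb lb ∧ L xb lb ≤ L x lb

/-- `g` is a subgradient of the extended-real-valued convex function `h` at `z`. -/
def ESubgradAt {m : ℕ} (h : En m → EReal) (g : En m) (z : En m) : Prop :=
  ∀ y : En m, h z + ((⟪g, y - z⟫ : ℝ) : EReal) ≤ h y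

/-- Closed form of the `x`-gradient of the augmented Lagrangian:
`∇f(x) + cEᵀ(Ex + λ/c - prox_{φ/c}(Ex + λ/c))`. -/
def gradALx {n m : ℕ} (f : En n → ℝ) (c : ℝ) (p : En m → En m)
    (E : En n →L[ℝ] En m) (lam : En m) (x : En n) : En n :=
  gradient f x +
    c • (ContinuousLinearMap.adjoint E) (E x + c⁻¹ • lam - p (E x + c⁻¹ • lam))

/-- The regularized objective `ψ(ξ) = L_c(ξ,λ) + (1/(2c))‖ξ - x‖²`. -/
def psiFun {n m : ℕ} (f : En n → ℝ) (φ : En m → EReal) (c : ℝ) (p : En m → En m)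
    (E : En n →L[ℝ] En m) (x : En n) (lam : En m) (ξ : En n) : ℝ :=
  AL f φ c p E ξ lam + 1 / (2 * c) * ‖ξ - x‖ ^ 2

/-- Closed form of `∇ψ`. -/
def gradPsi {n m : ℕ} (f : En n → ℝ) (c : ℝ) (p : En m → En m)
    (E : En n →L[ℝ] En m) (x : En n) (lam : En m) (ξ : En n) : En n :=
  gradALx f c p E lam ξ + c⁻¹ • (ξ - x)

/-- Limiting (B-) Jacobian: limits of Jacobians along sequences of points of
differentiability. -/
def limJac {a b : ℕ} (Φ : En a → En b) (x : En a) : Set (En a →L[ℝ] En b) :=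
  {G | ∃ u : ℕ → En a, (∀ k, DifferentiableAt ℝ Φ (u k)) ∧
        Tendsto u atTop (𝓝 x) ∧ Tendsto (fun k => fderiv ℝ Φ (u k)) atTop (𝓝 G)}

/-- Clarke generalized Jacobian. -/
def clarkeJac {a b : ℕ} (Φ : En a → En b) (x : En a) : Set (En a →L[ℝ] En b) :=
  convexHull ℝ (limJac Φ x)

/-- Symmetry (self-adjointness) of a continuous linear operator. -/
def SymCLM {k : ℕ} (A : En k →L[ℝ] En k) : Prop :=
  ∀ u v : En k, ⟪A u, v⟫ = ⟪u, A v⟫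

/-- Loewner order `A ⪯ B`. -/
def Loew {k : ℕ} (A B : En k →L[ℝ] En k) : Prop :=
  ∀ d : En k, ⟪d, A d⟫ ≤ ⟪d, B d⟫

/-- The set `T(ξ)` of generalized Hessians
`∇²f(ξ) + c⁻¹I + cEᵀ(I - G)E`, `G ∈ ∂prox_{φ/c}(Eξ + λ/c)`. -/
def Tset {n m : ℕ} (f : En n → ℝ) (c : ℝ) (p : En m → En m) (E : En n →L[ℝ] En m)
    (lam : En m) (ξ : En n) : Set (En n →L[ℝ] En n) :=
  {V | ∃ G ∈ clarkeJac p (E ξ + c⁻¹ • lam),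
      V = fderiv ℝ (gradient f) ξ + c⁻¹ • ContinuousLinearMap.id ℝ (En n) +
          c • ((ContinuousLinearMap.adjoint E).comp
                ((ContinuousLinearMap.id ℝ (En m) - G).comp E))}

/-- One-sided directional differentiability. -/
def DirDiffAt {a b : ℕ} (Φ : En a → En b) (y d : En a) : Prop :=
  ∃ D : En b, Tendsto (fun t : ℝ => t⁻¹ • (Φ (y + t • d) - Φ y)) (𝓝[>] (0 : ℝ)) (𝓝 D)

/-- Semismoothness at a point. -/
def SemismoothAt {a b : ℕ} (Φ : En a → En b) (xb : En a) : Prop :=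
  LocallyLipschitz Φ ∧ (∀ᶠ y in 𝓝 xb, ∀ d, DirDiffAt Φ y d) ∧
    ∀ ε > 0, ∃ δ > 0, ∀ x : En a, x ≠ xb → ‖x - xb‖ < δ →
      ∀ G ∈ clarkeJac Φ x, ‖Φ x + G (xb - x) - Φ xb‖ ≤ ε * ‖x - xb‖

/-- Strong semismoothness at a point. -/
def StronglySemismoothAt {a b : ℕ} (Φ : En a → En b) (xb : En a) : Prop :=
  LocallyLipschitz Φ ∧ (∀ᶠ y in 𝓝 xb, ∀ d, DirDiffAt Φ y d) ∧
    ∃ C : ℝ, ∃ δ > 0, ∀ x : En a, ‖x - xb‖ < δ →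
      ∀ G ∈ clarkeJac Φ x, ‖Φ x + G (xb - x) - Φ xb‖ ≤ C * ‖x - xb‖ ^ 2

/-- Linear Newton approximation (LNA) scheme of `Φ` at `xb`. -/
def IsLNAAt {a : ℕ} (S : En a → Set (En a →L[ℝ] En a)) (Φ : En a → En a)
    (xb : En a) : Prop :=
  (∀ η, (S η).Nonempty ∧ IsCompact (S η)) ∧
  (∀ U : Set (En a →L[ℝ] En a), IsOpen U → S xb ⊆ U → ∀ᶠ η in 𝓝 xb, S η ⊆ U) ∧
  ∀ ε > 0, ∃ δ > 0, ∀ η : En a, η ≠ xb → ‖η - xb‖ < δ →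
    ∀ H ∈ S η, ‖Φ η + H (xb - η) - Φ xb‖ ≤ ε * ‖η - xb‖

/-- Strong linear Newton approximation scheme of `Φ` at `xb`. -/
def IsStrongLNAAt {a : ℕ} (S : En a → Set (En a →L[ℝ] En a)) (Φ : En a → En a)
    (xb : En a) : Prop :=
  (∀ η, (S η).Nonempty ∧ IsCompact (S η)) ∧
  (∀ U : Set (En a →L[ℝ] En a), IsOpen U → S xb ⊆ U → ∀ᶠ η in 𝓝 xb, S η ⊆ U) ∧
  ∃ C : ℝ, ∃ δ > 0, ∀ η : En a, ‖η - xb‖ < δ →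
    ∀ H ∈ S η, ‖Φ η + H (xb - η) - Φ xb‖ ≤ C * ‖η - xb‖ ^ 2

/-- The Armijo condition with parameters `γ, ρ` at trial exponent `i`. -/
def ArmijoCond {n m : ℕ} (f : En n → ℝ) (φ : En m → EReal) (c : ℝ) (p : En m → En m)
    (E : En n →L[ℝ] En m) (x : En n) (lam : En m) (γ ρ : ℝ)
    (ξl dl : En n) (i : ℕ) : Prop :=
  psiFun f φ c p E x lam (ξl + ρ ^ i • dl)
    ≤ psiFun f φ c p E x lam ξl + γ * ρ ^ i * ⟪gradPsi f c p E x lam ξl, dl⟫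

set_option maxHeartbeats 1000000 in
theorem abs_newton {H : Type*} [NormedAddCommGroup H] [InnerProductSpace ℝ H] [CompleteSpace H]
    (ψ : H → ℝ) (F : H → H) (κ γ ρ : ℝ) (hκ : 0 < κ) (hγ0 : 0 < γ) (hγ1 : γ < 1/2)
    (hρ0 : 0 < ρ) (hρ1 : ρ < 1)
    (hA : ∀ u, HasGradientAt ψ (F u) u)
    (hB : ∀ u v, ψ u + ⟪F u, v - u⟫ + κ / 2 * ‖v - u‖ ^ 2 ≤ ψ v)
    (hC : ∀ R : ℝ, ∃ L > 0, ∀ u v, ‖u‖ ≤ R → ‖v‖ ≤ R → ‖F u - F v‖ ≤ L * ‖u - v‖)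
    (ξs : H) (hG : F ξs = 0)
    (ξ : ℕ → H) (V : ℕ → H →L[ℝ] H) (d : ℕ → H) (i : ℕ → ℕ)
    (hD : ∀ l v, κ * ‖v‖ ^ 2 ≤ ⟪V l v, v⟫)
    (hD' : ∀ R : ℝ, ∃ M : ℝ, ∀ l, ‖ξ l‖ ≤ R → ‖V l‖ ≤ M)
    (hE : ∀ ε > 0, ∃ δ > 0, ∀ l, ‖ξ l - ξs‖ < δ →
      ‖F (ξ l) + V l (ξs - ξ l)‖ ≤ ε * ‖ξ l - ξs‖)
    (hF : ∀ ε > 0, ∃ δ > 0, ∀ e, ‖e‖ < δ → ∀ t ∈ Icc (0:ℝ) 1,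
      ‖F (ξs + t • e) - t • F (ξs + e)‖ ≤ ε * ‖e‖)
    (hd : ∀ l, V l (d l) = - F (ξ l))
    (hi : ∀ l, ψ (ξ l + ρ ^ i l • d l) ≤ ψ (ξ l) + γ * ρ ^ i l * ⟪F (ξ l), d l⟫ ∧
      ∀ j < i l, ¬ ψ (ξ l + ρ ^ j • d l) ≤ ψ (ξ l) + γ * ρ ^ j * ⟪F (ξ l), d l⟫)
    (hstep : ∀ l, ξ (l + 1) = ξ l + ρ ^ i l • d l) :
    ∃ l₀ : ℕ, ∀ l ≥ l₀, i l = 0 := by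
  have hmin : ∀ u, ψ ξs + κ / 2 * ‖u - ξs‖ ^ 2 ≤ ψ u := by
    intro u; have := hB ξs u; simpa [hG] using this
  have hdesc : ∀ l, ⟪F (ξ l), d l⟫ ≤ - (κ * ‖d l‖ ^ 2) := by
    intro l
    have := hD l (d l)
    rw [hd l, inner_neg_left] at this
    linarith
  have coer : ∀ l v, κ * ‖v‖ ≤ ‖V l v‖ := by
    intro l v
    have h1 := hD l v
    have h2 := real_inner_le_norm (V l v) v
    rcases (norm_nonneg v).eq_or_lt with h | h
    · rw [← h]; simp
    · have : κ * ‖v‖ * ‖v‖ ≤ ‖V l v‖ * ‖v‖ := by nlinarith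
      exact le_of_mul_le_mul_right this h
  have hρp : ∀ k : ℕ, 0 < ρ ^ k := fun k => pow_pos hρ0 k
  have hdec : ∀ l, ψ (ξ (l+1)) ≤ ψ (ξ l) - γ * ρ ^ i l * (κ * ‖d l‖ ^ 2) := by
    intro l
    have h1 := (hi l).1
    rw [← hstep l] at h1
    have h2 := mul_le_mul_of_nonneg_left (hdesc l) (mul_pos hγ0 (hρp (i l))).le
    linarith
  have hanti : Antitone (fun l => ψ (ξ l)) := by
    apply antitone_nat_of_succ_le
    intro l
    have := hdec l
    have : 0 ≤ γ * ρ ^ i l * (κ * ‖d l‖ ^ 2) := by have := hρp (i l); positivity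
    linarith
  -- boundedness
  obtain ⟨R, hR⟩ : ∃ R : ℝ, ∀ l, ‖ξ l‖ ≤ R := by
    refine ⟨‖ξs‖ + (1 + 2 / κ * (ψ (ξ 0) - ψ ξs)), fun l => ?_⟩
    have h1 := hmin (ξ l)
    have h2 : ψ (ξ l) ≤ ψ (ξ 0) := hanti (Nat.zero_le l)
    have h3 : ‖ξ l‖ ≤ ‖ξs‖ + ‖ξ l - ξs‖ := by
      have := norm_add_le ξs (ξ l - ξs); simpa using this
    have h4 : ‖ξ l - ξs‖ ^ 2 ≤ 2 / κ * (ψ (ξ 0) - ψ ξs) := by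
      rw [div_mul_eq_mul_div, le_div_iff₀ hκ]; nlinarith
    nlinarith [sq_nonneg (‖ξ l - ξs‖ - 1/2)]
  obtain ⟨M, hM⟩ := hD' R
  have hFb : ∃ B : ℝ, ∀ l, ‖F (ξ l)‖ ≤ B := by
    obtain ⟨L, hL, hLL⟩ := hC (max R ‖ξs‖)
    refine ⟨L * (R + ‖ξs‖), fun l => ?_⟩
    have := hLL (ξ l) ξs ((hR l).trans (le_max_left _ _)) (le_max_right _ _)
    rw [hG, sub_zero] at this
    have h2 := norm_sub_le (ξ l) ξs
    have h3 := hR l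
    refine this.trans (by gcongr; linarith)
  obtain ⟨B, hBd⟩ := hFb
  have hdb : ∀ l, ‖d l‖ ≤ B / κ := by
    intro l
    have := coer l (d l)
    rw [hd l, norm_neg] at this
    rw [le_div_iff₀ hκ]; linarith [hBd l]
  obtain ⟨L, hL, hLL⟩ := hC (R + B / κ)
  have htrial : ∀ l (t : ℝ), 0 < t → t ≤ 1 → L * t ≤ (1 - γ) * κ →
      ψ (ξ l + t • d l) ≤ ψ (ξ l) + γ * t * ⟪F (ξ l), d l⟫ := by
    intro l t ht ht1 hle
    have h1 := hB (ξ l + t • d l) (ξ l)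
    have e1 : ξ l - (ξ l + t • d l) = - (t • d l) := by abel
    rw [e1, inner_neg_right, inner_smul_right] at h1
    have h2 : ‖F (ξ l + t • d l) - F (ξ l)‖ ≤ L * (t * ‖d l‖) := by
      have := hLL (ξ l + t • d l) (ξ l) (by
        refine (norm_add_le _ _).trans ?_
        rw [norm_smul, Real.norm_of_nonneg ht.le]
        have := hdb l; have := hR l
        nlinarith [norm_nonneg (d l)]) (by
        have := hR l; have := hdb l; linarith [norm_nonneg (d l)])
      simpa [norm_smul, abs_of_pos ht] using this
    have h3 : ⟪F (ξ l + t • d l) - F (ξ l), d l⟫ ≤ L * (t * ‖d l‖) * ‖d l‖ :=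
      (real_inner_le_norm _ _).trans (by gcongr)
    rw [inner_sub_left] at h3
    have h4 := hdesc l
    have h5 : 0 ≤ κ / 2 * ‖-(t • d l)‖ ^ 2 := by positivity
    have h6 : L * (t * ‖d l‖) * ‖d l‖ ≤ (1 - γ) * (κ * ‖d l‖ ^ 2) := by
      have := mul_le_mul_of_nonneg_right hle (sq_nonneg ‖d l‖)
      nlinarith
    have h7 : ⟪F (ξ l + t • d l), d l⟫ ≤ γ * ⟪F (ξ l), d l⟫ := by
      have : (1-γ) * ⟪F (ξ l), d l⟫ ≤ (1-γ) * (-(κ * ‖d l‖ ^ 2)) :=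
        mul_le_mul_of_nonneg_left h4 (by linarith)
      linarith
    have := mul_le_mul_of_nonneg_left h7 ht.le
    linarith
  -- step lower bound
  obtain ⟨τ, hτ, hττ⟩ : ∃ τ > 0, ∀ l, τ ≤ ρ ^ i l := by
    refine ⟨min 1 (ρ * ((1 - γ) * κ / L)), ?_, fun l => ?_⟩
    · have : 0 < 1 - γ := by linarith
      positivity
    · rcases Nat.eq_zero_or_pos (i l) with h | h
      · rw [h, pow_zero]; exact min_le_left _ _
      · refine (min_le_right _ _).trans ?_
        have h1 := (hi l).2 (i l - 1) (by omega)
        have h2 : ¬ (L * ρ ^ (i l - 1) ≤ (1 - γ) * κ) := fun h3 =>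
          h1 (htrial l _ (hρp _) (pow_le_one₀ hρ0.le hρ1.le) h3)
        push Not at h2
        have h3 : ρ ^ i l = ρ * ρ ^ (i l - 1) := by
          rw [← pow_succ']; congr 1; omega
        rw [h3]
        gcongr
        rw [div_le_iff₀ hL]; linarith
  -- convergence
  have hlim : Tendsto (fun l => ξ l) atTop (𝓝 ξs) := by
    have hbb : BddBelow (range fun l => ψ (ξ l)) := by
      refine ⟨ψ ξs, ?_⟩
      rintro _ ⟨l, rfl⟩
      have := hmin (ξ l)
      have : 0 ≤ κ / 2 * ‖ξ l - ξs‖ ^ 2 := by positivity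
      simp only; linarith
    have hc := tendsto_atTop_ciInf hanti hbb
    have hdiff : Tendsto (fun l => ψ (ξ l) - ψ (ξ (l+1))) atTop (𝓝 0) := by
      have := hc.sub (hc.comp (tendsto_add_atTop_nat 1))
      simpa using this
    have hM0 : 0 ≤ M := (norm_nonneg _).trans (hM 0 (hR 0))
    have hbound : ∀ l, γ * τ * κ * κ ^ 2 * ‖ξ l - ξs‖ ^ 2 ≤ M ^ 2 * (ψ (ξ l) - ψ (ξ (l+1))) := by
      intro l
      have h1 := hdec l
      have h2 : γ * τ * (κ * ‖d l‖ ^ 2) ≤ ψ (ξ l) - ψ (ξ (l+1)) := by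
        have : γ * τ * (κ * ‖d l‖ ^ 2) ≤ γ * ρ ^ i l * (κ * ‖d l‖ ^ 2) := by
          gcongr; exact hττ l
        linarith
      have h3 : ‖F (ξ l)‖ ≤ M * ‖d l‖ := by
        rw [← norm_neg, ← hd l]
        exact (V l).le_of_opNorm_le (hM l (hR l)) _
      have h4 : κ * ‖ξ l - ξs‖ ≤ ‖F (ξ l)‖ := by
        have a1 := hB (ξ l) ξs
        have a2 := hmin (ξ l)
        rw [norm_sub_rev] at a1
        have a3 : ⟪F (ξ l), ξs - ξ l⟫ = - ⟪F (ξ l), ξ l - ξs⟫ := by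
          rw [← inner_neg_right, neg_sub]
        have a4 := real_inner_le_norm (F (ξ l)) (ξ l - ξs)
        rcases (norm_nonneg (ξ l - ξs)).eq_or_lt with h | h
        · rw [← h]; simp
        · refine le_of_mul_le_mul_right ?_ h
          nlinarith
      have h5 : (κ * ‖ξ l - ξs‖) ^ 2 ≤ (M * ‖d l‖) ^ 2 := by
        have := h4.trans h3
        gcongr
      have h6 := mul_le_mul_of_nonneg_left h5 (by positivity : 0 ≤ γ * τ * κ)
      have h7 := mul_le_mul_of_nonneg_left h2 (by positivity : 0 ≤ M ^ 2)
      nlinarith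
    have hsq : Tendsto (fun l => ‖ξ l - ξs‖ ^ 2) atTop (𝓝 0) := by
      have h0 : 0 < γ * τ * κ * κ ^ 2 := by positivity
      refine squeeze_zero (fun l => by positivity)
        (g := fun l => M ^ 2 / (γ * τ * κ * κ ^ 2) * (ψ (ξ l) - ψ (ξ (l+1)))) (fun l => ?_) ?_
      · rw [div_mul_eq_mul_div, le_div_iff₀ h0]; linarith [hbound l]
      · simpa using hdiff.const_mul (M ^ 2 / (γ * τ * κ * κ ^ 2))
    rw [tendsto_iff_norm_sub_tendsto_zero]
    have := hsq.sqrt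
    simpa [Real.sqrt_sq] using this
  -- local analysis
  obtain ⟨K, hK, hKK⟩ := hC (‖ξs‖ + 1)
  set s : ℝ := min (1/2) ((1/2 - γ) * κ / (4 * (K + κ))) with hs
  have hγ' : 0 < 1/2 - γ := by linarith
  have hs0 : 0 < s := by rw [hs]; positivity
  have hs1 : s ≤ 1/2 := min_le_left _ _
  have hs2 : s * (4 * (K + κ)) ≤ (1/2 - γ) * κ := by
    rw [← le_div_iff₀ (by positivity)]; exact min_le_right _ _
  obtain ⟨δ₁, hδ₁, hE'⟩ := hE (κ * s) (by positivity)
  obtain ⟨δ₂, hδ₂, hF'⟩ := hF (κ * s) (by positivity)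
  have hev : ∀ᶠ l in atTop, ‖ξ l - ξs‖ < min 1 (min δ₁ δ₂) := by
    have := (tendsto_iff_norm_sub_tendsto_zero.1 hlim)
    exact this.eventually_lt_const (by positivity)
  obtain ⟨l₀, hl₀⟩ := eventually_atTop.1 hev
  refine ⟨l₀, fun l hl => ?_⟩
  have hlt := hl₀ l hl
  rw [lt_min_iff, lt_min_iff] at hlt
  obtain ⟨b0, b1, b2⟩ := hlt
  by_contra hne
  refine (hi l).2 0 (Nat.pos_of_ne_zero hne) ?_
  rw [pow_zero, one_smul, mul_one]
  obtain ⟨e, he⟩ : ∃ e, e = ξ l - ξs := ⟨_, rfl⟩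
  obtain ⟨w, hw⟩ : ∃ w, w = e + d l := ⟨_, rfl⟩
  have hξ : ξ l = ξs + e := by rw [he]; abel
  rw [← he] at b0 b1 b2
  have w1 : ‖w‖ ≤ s * ‖e‖ := by
    have h1 := hE' l (by rw [← he]; exact b1)
    have h2 : F (ξ l) + V l (ξs - ξ l) = - V l w := by
      have : ξs - ξ l = - e := by rw [he]; abel
      rw [this, hw, map_add, map_neg, hd l]; abel
    rw [h2, norm_neg, ← he] at h1
    have h3 := (coer l w).trans h1
    rw [mul_assoc] at h3
    exact le_of_mul_le_mul_left h3 hκ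
  have w2 : ‖e‖ ≤ 2 * ‖d l‖ := by
    have h1 : ‖e‖ ≤ ‖w‖ + ‖d l‖ := by
      have := norm_sub_le w (d l); rwa [hw, add_sub_cancel_right, ← hw] at this
    have := mul_le_mul_of_nonneg_right hs1 (norm_nonneg e)
    linarith
  have hw1 : ‖w‖ ≤ 1 := by nlinarith [norm_nonneg e]
  have FL : ∀ u, ‖u‖ ≤ 1 → ‖F (ξs + u)‖ ≤ K * ‖u‖ := by
    intro u hu
    have := hKK (ξs + u) ξs ((norm_add_le _ _).trans (by linarith)) (by linarith)
    simpa [hG] using this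
  have c1 : ψ (ξ l + d l) - ψ ξs ≤ K * ‖w‖ ^ 2 := by
    have h1 : ξ l + d l = ξs + w := by rw [hw, hξ]; abel
    have h2 := hB (ξs + w) ξs
    have h3 : ξs - (ξs + w) = -w := by abel
    rw [h3, inner_neg_right] at h2
    have h4 := real_inner_le_norm (F (ξs + w)) w
    have h5 : ‖F (ξs + w)‖ * ‖w‖ ≤ K * ‖w‖ * ‖w‖ := by gcongr; exact FL w hw1
    have h6 : 0 ≤ κ / 2 * ‖-w‖ ^ 2 := by positivity
    rw [h1]; nlinarith
  have c2 : 1/2 * ⟪F (ξ l), e⟫ - κ * s * ‖e‖ ^ 2 ≤ ψ (ξ l) - ψ ξs := by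
    have hder : ∀ t : ℝ, HasDerivAt (fun t : ℝ => ψ (ξs + t • e) - t ^ 2 / 2 * ⟪F (ξ l), e⟫)
        (⟪F (ξs + t • e) - t • F (ξ l), e⟫) t := by
      intro t
      have h1 : HasDerivAt (fun t : ℝ => ξs + t • e) e t := by
        simpa using ((hasDerivAt_id t).smul_const e).const_add ξs
      have h2 := (hA (ξs + t • e)).hasFDerivAt.comp_hasDerivAt t h1
      have h3 : HasDerivAt (fun t : ℝ => t ^ 2 / 2 * ⟪F (ξ l), e⟫) (t * ⟪F (ξ l), e⟫) t := by
        have := ((hasDerivAt_pow 2 t).div_const 2).mul_const ⟪F (ξ l), e⟫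
        refine this.congr_deriv ?_
        norm_num
      have := h2.sub h3
      refine this.congr_deriv ?_
      rw [inner_sub_left, inner_smul_left]; simp
    have := norm_image_sub_le_of_norm_deriv_le_segment_01'
      (f := fun t : ℝ => ψ (ξs + t • e) - t ^ 2 / 2 * ⟪F (ξ l), e⟫)
      (f' := fun t : ℝ => ⟪F (ξs + t • e) - t • F (ξ l), e⟫) (C := κ * s * ‖e‖ * ‖e‖)
      (fun t _ => (hder t).hasDerivWithinAt) (fun t ht => by
        refine (norm_inner_le_norm _ _).trans ?_
        gcongr
        have := hF' e b2 t ⟨ht.1, ht.2.le⟩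
        rwa [← hξ] at this)
    simp only [one_smul, zero_smul, add_zero, ← hξ] at this
    rw [Real.norm_eq_abs, abs_le] at this
    have := this.1
    nlinarith
  have c3 : ⟪F (ξ l), e⟫ ≥ - (K * ‖e‖ * ‖w‖) - ⟪F (ξ l), d l⟫ := by
    have h1 : e = w - d l := by rw [hw]; abel
    have h2 : ⟪F (ξ l), e⟫ = ⟪F (ξ l), w⟫ - ⟪F (ξ l), d l⟫ := by
      conv_lhs => rw [h1]
      rw [inner_sub_right]
    have h3 := neg_le_of_abs_le (abs_real_inner_le_norm (F (ξ l)) w)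
    have h4 : ‖F (ξ l)‖ * ‖w‖ ≤ K * ‖e‖ * ‖w‖ := by
      gcongr; rw [hξ]; exact FL e b0.le
    linarith
  have c4 : K * ‖w‖ ^ 2 + κ * s * ‖e‖ ^ 2 + 1/2 * (K * ‖e‖ * ‖w‖) ≤ (K + κ) * s * ‖e‖ ^ 2 := by
    have h1 : K * ‖e‖ * ‖w‖ ≤ K * ‖e‖ * (s * ‖e‖) := by gcongr
    have h2 : K * ‖w‖ ^ 2 ≤ K * (s * ‖e‖) ^ 2 := by gcongr
    have h3 : K * (s * ‖e‖) ^ 2 ≤ K * (1/2 * s * ‖e‖ ^ 2) := by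
      have : s * s * ‖e‖ ^ 2 ≤ 1/2 * s * ‖e‖ ^ 2 := by gcongr
      have := mul_le_mul_of_nonneg_left this hK.le
      nlinarith
    nlinarith
  have c5 : (K + κ) * s * ‖e‖ ^ 2 ≤ (1/2 - γ) * (κ * ‖d l‖ ^ 2) := by
    have h1 : ‖e‖ ^ 2 ≤ (2 * ‖d l‖) ^ 2 := by gcongr
    have h2 : (K + κ) * s * ‖e‖ ^ 2 ≤ (K + κ) * s * (2 * ‖d l‖) ^ 2 := by gcongr
    have h3 := mul_le_mul_of_nonneg_right hs2 (sq_nonneg ‖d l‖)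
    nlinarith
  have c6 := mul_le_mul_of_nonneg_left (hdesc l) hγ'.le
  linarith

theorem prox_fin {m : ℕ} {φ : En m → EReal} (hφ : ProperLscConvex φ) {c : ℝ}
    {p : En m → En m} (hp : IsProx φ c p) (z : En m) :
    ((φ (p z)).toReal : EReal) = φ (p z) := by
  refine EReal.coe_toReal ?_ (hφ.1 _)
  obtain ⟨z0, hz0⟩ := hφ.2.1
  intro h
  have := (hp z).1 z0
  rw [h, EReal.top_add_coe, top_le_iff] at this
  exact EReal.add_ne_top hz0 (EReal.coe_ne_top _) this

theorem prox_sub {m : ℕ} {φ : En m → EReal} (hφ : ProperLscConvex φ) {c : ℝ} (hc : 0 < c)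
    {p : En m → En m} (hp : IsProx φ c p) (z w : En m) :
    (φ (p z)).toReal + c * ⟪z - p z, p w - p z⟫ ≤ (φ (p w)).toReal := by
  set A := (φ (p z)).toReal with hA
  set B := (φ (p w)).toReal with hB
  have key : ∀ t : ℝ, 0 < t → t ≤ 1 →
      A + c * ⟪z - p z, p w - p z⟫ ≤ B + t * (c / 2 * ‖p w - p z‖ ^ 2) := by
    intro t ht ht1
    have h1 := (hp z).1 ((1 - t) • p z + t • p w)
    have h2 := hφ.2.2.2 (p z) (p w) (1 - t) t (by linarith) ht.le (by ring)
    rw [← prox_fin hφ hp z, ← prox_fin hφ hp w, ← hA, ← hB] at h2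
    rw [← prox_fin hφ hp z, ← hA] at h1
    have h3 := h1.trans (add_le_add_left h2 _)
    have h4 : A + c / 2 * ‖p z - z‖ ^ 2 ≤ (1 - t) * A + t * B
        + c / 2 * ‖(1 - t) • p z + t • p w - z‖ ^ 2 := by exact_mod_cast h3
    have e1 : (1 - t) • p z + t • p w - z = (p z - z) + t • (p w - p z) := by
      rw [sub_smul, smul_sub, one_smul]; abel
    have e2 : ⟪p z - z, p w - p z⟫ = - ⟪z - p z, p w - p z⟫ := by
      rw [← inner_neg_left, neg_sub]
    rw [e1, norm_add_sq_real, inner_smul_right, norm_smul, Real.norm_of_nonneg ht.le, e2] at h4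
    have : t * (A + c * ⟪z - p z, p w - p z⟫) ≤ t * (B + t * (c / 2 * ‖p w - p z‖ ^ 2)) := by
      nlinarith
    exact le_of_mul_le_mul_left this ht
  have hlim : Tendsto (fun t : ℝ => B + t * (c / 2 * ‖p w - p z‖ ^ 2)) (𝓝[>] 0) (𝓝 B) := by
    have : Continuous (fun t : ℝ => B + t * (c / 2 * ‖p w - p z‖ ^ 2)) := by fun_prop
    have := this.tendsto 0
    simp only [zero_mul, add_zero] at this
    exact this.mono_left nhdsWithin_le_nhds
  refine ge_of_tendsto hlim ?_
  filter_upwards [Ioc_mem_nhdsGT (zero_lt_one' ℝ)] with t ht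
  exact key t ht.1 ht.2

theorem prox_firm {m : ℕ} {φ : En m → EReal} (hφ : ProperLscConvex φ) {c : ℝ} (hc : 0 < c)
    {p : En m → En m} (hp : IsProx φ c p) (z w : En m) :
    ‖p z - p w‖ ^ 2 ≤ ⟪p z - p w, z - w⟫ := by
  have h1 := prox_sub hφ hc hp z w
  have h2 := prox_sub hφ hc hp w z
  have h3 : c * (⟪z - p z, p w - p z⟫ + ⟪w - p w, p z - p w⟫) ≤ c * 0 := by linarith
  have h4 := le_of_mul_le_mul_left h3 hc
  have e : ⟪z - p z, p w - p z⟫ + ⟪w - p w, p z - p w⟫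
      = ‖p z - p w‖ ^ 2 - ⟪p z - p w, z - w⟫ := by
    rw [← real_inner_self_eq_norm_sq]
    simp only [inner_sub_left, inner_sub_right, real_inner_comm]
    ring
  linarith

theorem prox_lip {m : ℕ} {φ : En m → EReal} (hφ : ProperLscConvex φ) {c : ℝ} (hc : 0 < c)
    {p : En m → En m} (hp : IsProx φ c p) (z w : En m) :
    ‖p z - p w‖ ≤ ‖z - w‖ := by
  have h1 := prox_firm hφ hc hp z w
  have h2 := real_inner_le_norm (p z - p w) (z - w)
  rcases (norm_nonneg (p z - p w)).eq_or_lt with h | h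
  · rw [← h]; positivity
  · refine le_of_mul_le_mul_left ?_ h
    nlinarith

theorem menv_lower {m : ℕ} {φ : En m → EReal} (hφ : ProperLscConvex φ) {c : ℝ} (hc : 0 < c)
    {p : En m → En m} (hp : IsProx φ c p) (z w : En m) :
    menv φ c p z + c * ⟪z - p z, w - z⟫ ≤ menv φ c p w := by
  have h1 := prox_sub hφ hc hp z w
  unfold menv
  obtain ⟨a, ha⟩ : ∃ a, a = z - p z := ⟨_, rfl⟩
  obtain ⟨b, hb⟩ : ∃ b, b = w - p w := ⟨_, rfl⟩
  have e1 : p w - p z = (w - z) + (a - b) := by rw [ha, hb]; abel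
  have e2 : p z - z = -a := by rw [ha]; abel
  have e3 : p w - w = -b := by rw [hb]; abel
  rw [← ha, e1, inner_add_right, inner_sub_right a a b, real_inner_self_eq_norm_sq] at h1
  rw [← ha, e2, e3, norm_neg, norm_neg]
  have h2 : 0 ≤ c * ‖a - b‖ ^ 2 := by positivity
  rw [norm_sub_sq_real] at h2
  nlinarith

theorem menv_grad {m : ℕ} {φ : En m → EReal} (hφ : ProperLscConvex φ) {c : ℝ} (hc : 0 < c)
    {p : En m → En m} (hp : IsProx φ c p) (z : En m) :
    HasGradientAt (menv φ c p) (c • (z - p z)) z := by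
  rw [hasGradientAt_iff_isLittleO]
  refine Asymptotics.IsBigO.trans_isLittleO (g := fun w => ‖w - z‖ ^ 2) ?_ ?_
  · refine Asymptotics.IsBigO.of_bound c (Eventually.of_forall fun w => ?_)
    have h1 := menv_lower hφ hc hp z w
    have h2 := menv_lower hφ hc hp w z
    have h3 := prox_firm hφ hc hp w z
    have e : ⟪w - p w, z - w⟫ = ⟪p w - p z, w - z⟫ - ‖w - z‖ ^ 2 - ⟪z - p z, w - z⟫ := by
      rw [← real_inner_self_eq_norm_sq]
      simp only [inner_sub_left, inner_sub_right, real_inner_comm]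
      ring
    rw [e] at h2
    rw [inner_smul_left, Real.norm_eq_abs, Real.norm_of_nonneg (by positivity)]
    simp only [conj_trivial]
    have h4 : 0 ≤ c * ⟪p w - p z, w - z⟫ := mul_nonneg hc.le ((sq_nonneg _).trans h3)
    have h5 : 0 ≤ c * ‖w - z‖ ^ 2 := by positivity
    rw [abs_le]
    constructor <;> nlinarith
  · have : (fun w : En m => ‖w - z‖ ^ 2) =o[𝓝 z] fun w => ‖w - z‖ ^ 1 :=
      Asymptotics.isLittleO_pow_sub_pow_sub z (by norm_num)
    simp only [pow_one] at this
    exact this.of_norm_right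

theorem clarke_norm {m : ℕ} {p : En m → En m} (hp : ∀ z w, ‖p z - p w‖ ≤ ‖z - w‖)
    (z : En m) (G : En m →L[ℝ] En m) (hG : G ∈ clarkeJac p z) : ‖G‖ ≤ 1 := by
  have hl : LipschitzWith 1 p := LipschitzWith.of_dist_le_mul (by
    intro a b; simpa [dist_eq_norm] using hp a b)
  have : clarkeJac p z ⊆ Metric.closedBall 0 1 := by
    refine convexHull_min ?_ (convex_closedBall _ _)
    rintro G ⟨u, -, -, h⟩
    refine Metric.isClosed_closedBall.mem_of_tendsto h (Eventually.of_forall fun k => ?_)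
    rw [mem_closedBall_zero_iff]
    simpa using norm_fderiv_le_of_lipschitz ℝ hl (x₀ := u k)
  simpa using this hG

theorem dirdiff_unif {m : ℕ} {p : En m → En m} (hp : ∀ z w, ‖p z - p w‖ ≤ ‖z - w‖)
    (z : En m) (hz : ∀ d, DirDiffAt p z d) (ε : ℝ) (hε : 0 < ε) :
    ∃ δ > 0, ∀ h : En m, ‖h‖ < δ → ∀ t ∈ Icc (0:ℝ) 1,
      ‖p (z + t • h) - p z - t • (p (z + h) - p z)‖ ≤ ε * ‖h‖ := by
  choose D hD using hz
  set η := ε / 4 with hη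
  have hη0 : 0 < η := by positivity
  obtain ⟨N, -, hNf, hN⟩ := finite_cover_balls_of_compact (isCompact_sphere (0 : En m) 1) hη0
  have hDe : ∀ u, ∃ δ > 0, ∀ s : ℝ, 0 ≤ s → s < δ → ‖p (z + s • u) - p z - s • D u‖ ≤ η * s := by
    intro u
    have := (hD u)
    rw [Metric.tendsto_nhdsWithin_nhds] at this
    obtain ⟨δ, hδ, h⟩ := this η hη0
    refine ⟨δ, hδ, fun s hs hsδ => ?_⟩
    rcases hs.eq_or_lt with h0 | h0
    · rw [← h0]; simp
    · have h1 := (h (x := s) h0 (by rwa [Real.dist_eq, sub_zero, abs_of_pos h0])).le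
      rw [dist_eq_norm] at h1
      have e : p (z + s • u) - p z - s • D u = s • (s⁻¹ • (p (z + s • u) - p z) - D u) := by
        rw [smul_sub, smul_smul, mul_inv_cancel₀ h0.ne', one_smul]
      rw [e, norm_smul, Real.norm_of_nonneg hs, mul_comm]
      gcongr
  choose δ hδ hδD using hDe
  obtain ⟨δ', hδ', hle⟩ : ∃ δ' > 0, ∀ u ∈ N, δ' ≤ δ u := by
    rcases N.eq_empty_or_nonempty with h | h
    · exact ⟨1, one_pos, by simp [h]⟩
    · obtain ⟨u, hu, hmin⟩ := Set.exists_min_image N δ hNf h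
      exact ⟨δ u, hδ u, hmin⟩
  refine ⟨δ', hδ', fun h hh t ht => ?_⟩
  rcases eq_or_ne h 0 with h0 | h0
  · simp [h0]
  have hn : 0 < ‖h‖ := norm_pos_iff.2 h0
  have hu : ‖h‖⁻¹ • h ∈ Metric.sphere (0 : En m) 1 := by
    rw [mem_sphere_zero_iff_norm, norm_smul, norm_inv, norm_norm, inv_mul_cancel₀ hn.ne']
  obtain ⟨u, huN, hub⟩ := mem_iUnion₂.1 (hN hu)
  rw [Metric.mem_ball, dist_eq_norm] at hub
  have hhu : ‖h - ‖h‖ • u‖ ≤ η * ‖h‖ := by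
    have e : h - ‖h‖ • u = ‖h‖ • (‖h‖⁻¹ • h - u) := by
      rw [smul_sub, smul_smul, mul_inv_cancel₀ hn.ne', one_smul]
    rw [e, norm_smul, norm_norm, mul_comm]
    gcongr
  have main : ∀ t ∈ Icc (0:ℝ) 1, ‖p (z + t • h) - p z - (t * ‖h‖) • D u‖ ≤ 2 * η * (t * ‖h‖) := by
    intro t ht
    have h1 := hδD u (t * ‖h‖) (mul_nonneg ht.1 hn.le)
      (lt_of_lt_of_le (by nlinarith [ht.2]) (hle u huN))
    have h2 := hp (z + t • h) (z + (t * ‖h‖) • u)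
    have e : z + t • h - (z + (t * ‖h‖) • u) = t • (h - ‖h‖ • u) := by
      rw [smul_sub, smul_smul]; abel
    rw [e, norm_smul, Real.norm_of_nonneg ht.1] at h2
    have h3 := mul_le_mul_of_nonneg_left hhu ht.1
    have e2 : p (z + t • h) - p z - (t * ‖h‖) • D u
      = (p (z + t • h) - p (z + (t * ‖h‖) • u)) + (p (z + (t * ‖h‖) • u) - p z - (t * ‖h‖) • D u) := by
      abel
    rw [e2]
    refine (norm_add_le _ _).trans ?_
    linarith
  have m1 := main t ht
  have m2 := main 1 ⟨zero_le_one, le_rfl⟩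
  rw [one_smul, one_mul] at m2
  have e3 : p (z + t • h) - p z - t • (p (z + h) - p z)
    = (p (z + t • h) - p z - (t * ‖h‖) • D u) - t • (p (z + h) - p z - ‖h‖ • D u) := by
    rw [smul_sub t _ (‖h‖ • D u), smul_smul]; abel
  rw [e3]
  refine (norm_sub_le _ _).trans ?_
  rw [norm_smul, Real.norm_of_nonneg ht.1]
  have m3 := mul_le_mul_of_nonneg_left m2 ht.1
  have m4 : t * ‖h‖ ≤ ‖h‖ := by nlinarith [ht.2]
  have m5 := mul_le_mul_of_nonneg_left m4 hη0.le
  have : ε = 4 * η := by rw [hη]; ring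
  rw [this]
  nlinarith

theorem grad_c1 {n : ℕ} {f : En n → ℝ} (hf : ContDiff ℝ 2 f) : ContDiff ℝ 1 (gradient f) := by
  have h : ContDiff ℝ 1 (fderiv ℝ f) := hf.fderiv_right (by norm_num)
  exact (InnerProductSpace.toDual ℝ (En n)).symm.contDiff.comp h

theorem f_lower {n : ℕ} {f : En n → ℝ} (hf : ContDiff ℝ 2 f) (hc : ConvexOn ℝ Set.univ f)
    (u v : En n) : f u + ⟪gradient f u, v - u⟫ ≤ f v := by
  have hg : HasGradientAt f (gradient f u) u :=
    ((hf.differentiable (by norm_num)) u).hasGradientAt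
  have h1 : HasDerivAt (fun t : ℝ => u + t • (v - u)) (v - u) 0 := by
    simpa using ((hasDerivAt_id (0:ℝ)).smul_const (v - u)).const_add u
  have hg' : HasFDerivAt f (InnerProductSpace.toDual ℝ (En n) (gradient f u)) (u + (0:ℝ) • (v - u)) := by
    simpa using hg.hasFDerivAt
  have h2 := hg'.comp_hasDerivAt (0:ℝ) h1
  have h3 : ConvexOn ℝ Set.univ (f ∘ fun t : ℝ => u + t • (v - u)) := by
    refine ⟨convex_univ, fun a _ b _ s t hs ht hst => ?_⟩
    have := hc.2 (mem_univ (u + a • (v - u))) (mem_univ (u + b • (v - u))) hs ht hst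
    have hs' : s = 1 - t := by linarith
    have e : s • (u + a • (v - u)) + t • (u + b • (v - u)) = u + (s • a + t • b) • (v - u) := by
      subst hs'
      simp only [smul_eq_mul]
      module
    rw [e] at this
    exact this
  have h4 := h3.le_slope_of_hasDerivAt (mem_univ _) (mem_univ (1:ℝ)) zero_lt_one h2
  rw [slope_def_field, InnerProductSpace.toDual_apply_apply] at h4
  simp only [Function.comp, one_smul, zero_smul, add_zero, sub_zero, div_one,
    add_sub_cancel] at h4
  linarith

theorem hess_nonneg {n : ℕ} {f : En n → ℝ} (hf : ContDiff ℝ 2 f) (hc : ConvexOn ℝ Set.univ f)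
    (u v : En n) : 0 ≤ ⟪fderiv ℝ (gradient f) u v, v⟫ := by
  have hd : HasFDerivAt (gradient f) (fderiv ℝ (gradient f) u) u :=
    (((grad_c1 hf).differentiable (by norm_num)) u).hasFDerivAt
  have h1 : HasDerivAt (fun t : ℝ => u + t • v) v 0 := by
    simpa using ((hasDerivAt_id (0:ℝ)).smul_const v).const_add u
  have hd' : HasFDerivAt (gradient f) (fderiv ℝ (gradient f) u) (u + (0:ℝ) • v) := by
    simpa using hd
  have h2 := hd'.comp_hasDerivAt (0:ℝ) h1
  have h3 : HasDerivAt (fun t : ℝ => ⟪gradient f (u + t • v), v⟫)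
      ⟪fderiv ℝ (gradient f) u v, v⟫ 0 := by
    have := h2.inner ℝ (hasDerivAt_const (0:ℝ) v)
    simpa using this
  refine h3.nonneg_of_monotone ?_
  intro a b hab
  rcases hab.eq_or_lt with h | h
  · rw [h]
  have i1 := f_lower hf hc (u + a • v) (u + b • v)
  have i2 := f_lower hf hc (u + b • v) (u + a • v)
  have e1 : u + b • v - (u + a • v) = (b - a) • v := by module
  have e2 : u + a • v - (u + b • v) = -((b - a) • v) := by module
  rw [e1, inner_smul_right] at i1
  rw [e2, inner_neg_right, inner_smul_right] at i2
  refine le_of_mul_le_mul_left ?_ (sub_pos.2 h)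
  linarith

theorem c1_unif {n : ℕ} {g : En n → En n} (hg : ContDiff ℝ 1 g) (z : En n) (ε : ℝ) (hε : 0 < ε) :
    ∃ δ > 0, ∀ h : En n, ‖h‖ < δ → ∀ t ∈ Icc (0:ℝ) 1,
      ‖g (z + t • h) - g z - t • (g (z + h) - g z)‖ ≤ ε * ‖h‖ := by
  have hd : HasFDerivAt g (fderiv ℝ g z) z := ((hg.differentiable (by norm_num)) z).hasFDerivAt
  have := hd.isLittleO.def (half_pos hε)
  obtain ⟨δ, hδ, hh⟩ := Metric.eventually_nhds_iff.1 this
  refine ⟨δ, hδ, fun h hlt t ht => ?_⟩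
  have main : ∀ t ∈ Icc (0:ℝ) 1, ‖g (z + t • h) - g z - t • fderiv ℝ g z h‖ ≤ ε / 2 * (t * ‖h‖) := by
    intro t ht
    have := hh (y := z + t • h) (by
      rw [dist_eq_norm, add_sub_cancel_left, norm_smul, Real.norm_of_nonneg ht.1]
      nlinarith [ht.2, norm_nonneg h])
    rwa [add_sub_cancel_left, map_smul, norm_smul, Real.norm_of_nonneg ht.1] at this
  have m1 := main t ht
  have m2 := main 1 ⟨zero_le_one, le_rfl⟩
  rw [one_smul, one_smul, one_mul] at m2
  have e : g (z + t • h) - g z - t • (g (z + h) - g z)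
    = (g (z + t • h) - g z - t • fderiv ℝ g z h) - t • (g (z + h) - g z - fderiv ℝ g z h) := by
    module
  rw [e]
  refine (norm_sub_le _ _).trans ?_
  rw [norm_smul, Real.norm_of_nonneg ht.1]
  have m3 := mul_le_mul_of_nonneg_left m2 ht.1
  have m4 : t * ‖h‖ ≤ ‖h‖ := by nlinarith [ht.2, norm_nonneg h]
  have m5 := mul_le_mul_of_nonneg_left m4 hε.le
  nlinarith

theorem c1_semi {n : ℕ} {g : En n → En n} (hg : ContDiff ℝ 1 g) (z : En n) (ε : ℝ) (hε : 0 < ε) :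
    ∃ δ > 0, ∀ y : En n, ‖y - z‖ < δ →
      ‖g y + fderiv ℝ g y (z - y) - g z‖ ≤ ε * ‖y - z‖ := by
  have hd : HasFDerivAt g (fderiv ℝ g z) z := ((hg.differentiable (by norm_num)) z).hasFDerivAt
  have h1 := hd.isLittleO.def (half_pos hε)
  have h2 : ∀ᶠ y in 𝓝 z, dist (fderiv ℝ g y) (fderiv ℝ g z) < ε / 2 :=
    (hg.continuous_fderiv (by norm_num)).continuousAt.eventually (Metric.ball_mem_nhds _ (half_pos hε))
  obtain ⟨δ, hδ, hh⟩ := Metric.eventually_nhds_iff.1 (h1.and h2)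
  refine ⟨δ, hδ, fun y hy => ?_⟩
  obtain ⟨a, b⟩ := hh (y := y) (by rwa [dist_eq_norm])
  rw [dist_eq_norm] at b
  have e : g y + fderiv ℝ g y (z - y) - g z
     = (g y - g z - fderiv ℝ g z (y - z)) - (fderiv ℝ g y - fderiv ℝ g z) (y - z) := by
    rw [ContinuousLinearMap.sub_apply, ← neg_sub y z, map_neg]; abel
  rw [e]
  refine (norm_sub_le _ _).trans ?_
  have := (fderiv ℝ g y - fderiv ℝ g z).le_of_opNorm_le b.le (y - z)
  linarith

theorem c1_lip {n : ℕ} {g : En n → En n} (hg : ContDiff ℝ 1 g) (R : ℝ) :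
    ∃ L : ℝ, 0 ≤ L ∧ (∀ u, ‖u‖ ≤ R → ‖fderiv ℝ g u‖ ≤ L) ∧
      ∀ u v, ‖u‖ ≤ R → ‖v‖ ≤ R → ‖g u - g v‖ ≤ L * ‖u - v‖ := by
  obtain ⟨L, hL⟩ := (isCompact_closedBall (0 : En n) R).exists_bound_of_continuousOn
    (hg.continuous_fderiv (by norm_num)).continuousOn
  have hb : ∀ u, ‖u‖ ≤ R → ‖fderiv ℝ g u‖ ≤ max L 0 := fun u hu =>
    (hL u (by simpa using hu)).trans (le_max_left _ _)
  refine ⟨max L 0, le_max_right _ _, hb, fun u v hu hv => ?_⟩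
  exact (convex_closedBall (0 : En n) R).norm_image_sub_le_of_norm_fderiv_le (𝕜 := ℝ)
    (fun y _ => (hg.differentiable (by norm_num)) y)
    (fun y hy => hb y (by simpa using hy)) (by simpa using hv) (by simpa using hu)

theorem psi_grad {n m : ℕ} {f : En n → ℝ} (hf : ContDiff ℝ 2 f)
    {φ : En m → EReal} (hφ : ProperLscConvex φ) (E : En n →L[ℝ] En m)
    {c : ℝ} (hc : 0 < c) {p : En m → En m} (hp : IsProx φ c p)
    (x : En n) (lam : En m) (u : En n) :
    HasGradientAt (psiFun f φ c p E x lam) (gradPsi f c p E x lam u) u := by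
  have h1 : HasFDerivAt f (InnerProductSpace.toDual ℝ (En n) (gradient f u)) u :=
    ((hf.differentiable (by norm_num)) u).hasGradientAt.hasFDerivAt
  have hE : HasFDerivAt (fun ξ => E ξ + c⁻¹ • lam) E u := E.hasFDerivAt.add_const _
  have h2 := (menv_grad hφ hc hp (E u + c⁻¹ • lam)).hasFDerivAt.comp u hE
  have h3 := (((hasFDerivAt_id u).sub_const x).norm_sq).const_mul (1 / (2 * c))
  have h4 := ((h1.add h2).sub_const (‖lam‖ ^ 2 / (2 * c))).add h3
  rw [hasGradientAt_iff_hasFDerivAt]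
  refine HasFDerivAt.congr_fderiv (f := psiFun f φ c p E x lam) h4 ?_
  ext v
  have hc' : 1 / (2 * c) * 2 = c⁻¹ := by field_simp
  simp only [gradPsi, gradALx, ContinuousLinearMap.add_apply, ContinuousLinearMap.comp_apply,
    InnerProductSpace.toDual_apply_apply, ContinuousLinearMap.smul_apply, innerSL_apply_apply,
    inner_add_left, inner_smul_left, ContinuousLinearMap.adjoint_inner_left, conj_trivial,
    ContinuousLinearMap.id_apply, id, smul_eq_mul, nsmul_eq_mul, Nat.cast_ofNat]
  rw [← mul_assoc, hc']

theorem psi_lower {n m : ℕ} {f : En n → ℝ} (hf : ContDiff ℝ 2 f) (hfc : ConvexOn ℝ Set.univ f)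
    {φ : En m → EReal} (hφ : ProperLscConvex φ) (E : En n →L[ℝ] En m)
    {c : ℝ} (hc : 0 < c) {p : En m → En m} (hp : IsProx φ c p)
    (x : En n) (lam : En m) (u v : En n) :
    psiFun f φ c p E x lam u + ⟪gradPsi f c p E x lam u, v - u⟫ + c⁻¹ / 2 * ‖v - u‖ ^ 2
      ≤ psiFun f φ c p E x lam v := by
  have h1 := f_lower hf hfc u v
  have h2 := menv_lower hφ hc hp (E u + c⁻¹ • lam) (E v + c⁻¹ • lam)
  have e1 : E v + c⁻¹ • lam - (E u + c⁻¹ • lam) = E (v - u) := by rw [map_sub]; abel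
  have e2 : v - x = (u - x) + (v - u) := by abel
  have e3 : 1 / (2 * c) = c⁻¹ / 2 := by field_simp
  rw [e1] at h2
  simp only [psiFun, AL, gradPsi, gradALx]
  rw [e2, norm_add_sq_real, inner_add_left, inner_add_left, inner_smul_left, inner_smul_left,
    ContinuousLinearMap.adjoint_inner_left, e3]
  simp only [conj_trivial]
  linarith

set_option maxHeartbeats 1000000 in
theorem newton_unit_step_eventually {n m : ℕ} (f : En n → ℝ)
    (hf : ContDiff ℝ 2 f) (hfconv : ConvexOn ℝ Set.univ f)
    (φ : En m → EReal) (hφ : ProperLscConvex φ) (E : En n →L[ℝ] En m)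
    (c : ℝ) (hc : 0 < c) (p : En m → En m) (hp : IsProx φ c p)
    (x : En n) (lam : En m)
    (γ ρ : ℝ) (hγ : γ ∈ Set.Ioo (0 : ℝ) (1 / 2)) (hρ : ρ ∈ Set.Ioo (0 : ℝ) 1)
    (ξs : En n)
    (hmin : ∀ ξ : En n, ξ ≠ ξs →
      psiFun f φ c p E x lam ξs < psiFun f φ c p E x lam ξ)
    (hss : SemismoothAt p (E ξs + c⁻¹ • lam))
    (ξ : ℕ → En n) (V : ℕ → En n →L[ℝ] En n) (d : ℕ → En n) (i : ℕ → ℕ)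
    (hV : ∀ l, V l ∈ Tset f c p E lam (ξ l))
    (hd : ∀ l, V l (d l) = -gradPsi f c p E x lam (ξ l))
    (hi : ∀ l, ArmijoCond f φ c p E x lam γ ρ (ξ l) (d l) (i l) ∧
        ∀ j < i l, ¬ArmijoCond f φ c p E x lam γ ρ (ξ l) (d l) j)
    (hstep : ∀ l, ξ (l + 1) = ξ l + ρ ^ i l • d l) :
    ∃ l₀ : ℕ, ∀ l ≥ l₀, i l = 0 := by
  have hlip := prox_lip hφ hc hp
  have hg1 := grad_c1 hf
  have hci : 0 < c⁻¹ := inv_pos.2 hc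
  have hG0 : gradPsi f c p E x lam ξs = 0 := by
    have hloc : IsLocalMin (psiFun f φ c p E x lam) ξs := Eventually.of_forall fun u => by
      rcases eq_or_ne u ξs with h | h
      · rw [h]
      · exact (hmin u h).le
    have := hloc.hasFDerivAt_eq_zero (psi_grad hf hφ E hc hp x lam ξs).hasFDerivAt
    simpa using this
  obtain ⟨E', hE'⟩ : ∃ E' : En m →L[ℝ] En n, E' = ContinuousLinearMap.adjoint E := ⟨_, rfl⟩
  have hNE : ‖E'‖ = ‖E‖ := by rw [hE']; exact LinearIsometryEquiv.norm_map _ _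
  have hFdef : ∀ u, gradPsi f c p E x lam u = gradient f u + c • E' (E u + c⁻¹ • lam - p (E u + c⁻¹ • lam)) + c⁻¹ • (u - x) := by
    intro u; rw [hE']; rfl
  choose G hGm hVG using hV
  have hGn : ∀ l, ‖G l‖ ≤ 1 := fun l => clarke_norm hlip _ _ (hGm l)
  have hVa : ∀ l v, V l v = fderiv ℝ (gradient f) (ξ l) v + c⁻¹ • v + c • E' (E v - G l (E v)) := by
    intro l v
    rw [hVG l, hE']; simp
  have hEn : ∀ v, ‖E v‖ ≤ ‖E‖ * ‖v‖ := E.le_opNorm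
  have hEn' : ∀ v, ‖E' v‖ ≤ ‖E‖ * ‖v‖ := fun v => hNE ▸ E'.le_opNorm v
  refine abs_newton (psiFun f φ c p E x lam) (gradPsi f c p E x lam) c⁻¹ γ ρ hci hγ.1 hγ.2
    hρ.1 hρ.2 (psi_grad hf hφ E hc hp x lam) (psi_lower hf hfconv hφ E hc hp x lam) ?_ ξs hG0
    ξ V d i ?_ ?_ ?_ ?_ hd hi hstep
  · intro R
    obtain ⟨L, hL0, -, hL⟩ := c1_lip hg1 R
    refine ⟨L + c * (‖E‖ * (2 * ‖E‖)) + c⁻¹, by positivity, fun u v hu hv => ?_⟩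
    have e : gradPsi f c p E x lam u - gradPsi f c p E x lam v
      = (gradient f u - gradient f v) + c • E' (E (u - v) - (p (E u + c⁻¹ • lam) - p (E v + c⁻¹ • lam)))
        + c⁻¹ • (u - v) := by
      rw [hFdef, hFdef]; simp only [map_sub, map_add, map_smul]; module
    have hz : E u + c⁻¹ • lam - (E v + c⁻¹ • lam) = E (u - v) := by rw [map_sub]; abel
    have h1 := hlip (E u + c⁻¹ • lam) (E v + c⁻¹ • lam)
    rw [hz] at h1
    have h2 : ‖E (u - v) - (p (E u + c⁻¹ • lam) - p (E v + c⁻¹ • lam))‖ ≤ 2 * (‖E‖ * ‖u - v‖) := by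
      refine (norm_sub_le _ _).trans ?_
      linarith [hEn (u - v)]
    have h3 := (hEn' _).trans (mul_le_mul_of_nonneg_left h2 (norm_nonneg E))
    rw [e]
    refine (norm_add₃_le).trans ?_
    rw [norm_smul, norm_smul, Real.norm_of_nonneg hc.le, Real.norm_of_nonneg hci.le]
    have h4 := mul_le_mul_of_nonneg_left h3 hc.le
    have h5 := hL u v hu hv
    linarith
  · intro l v
    rw [hVa, inner_add_left, inner_add_left, inner_smul_left, inner_smul_left, hE',
      ContinuousLinearMap.adjoint_inner_left, inner_sub_left, real_inner_self_eq_norm_sq,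
      real_inner_self_eq_norm_sq]
    simp only [conj_trivial]
    have h1 := hess_nonneg hf hfconv (ξ l) v
    have h2 := real_inner_le_norm (G l (E v)) (E v)
    have h3 := (G l).le_of_opNorm_le (hGn l) (E v)
    have h4 : ‖G l (E v)‖ * ‖E v‖ ≤ (1 * ‖E v‖) * ‖E v‖ := by gcongr
    have h5 : 0 ≤ c * (‖E v‖ ^ 2 - ⟪G l (E v), E v⟫) := mul_nonneg hc.le (by nlinarith)
    linarith
  · intro R
    obtain ⟨L, hL0, hL, -⟩ := c1_lip hg1 R
    refine ⟨L + c⁻¹ + c * (‖E‖ * (2 * ‖E‖)), fun l hl => ?_⟩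
    refine ContinuousLinearMap.opNorm_le_bound _ (by positivity) fun v => ?_
    rw [hVa]
    refine (norm_add₃_le).trans ?_
    rw [norm_smul, norm_smul, Real.norm_of_nonneg hc.le, Real.norm_of_nonneg hci.le]
    have h1 := (fderiv ℝ (gradient f) (ξ l)).le_of_opNorm_le (hL _ hl) v
    have h2 : ‖E v - G l (E v)‖ ≤ 2 * (‖E‖ * ‖v‖) := by
      refine (norm_sub_le _ _).trans ?_
      linarith [hEn v, (G l).le_of_opNorm_le (hGn l) (E v)]
    have h3 := (hEn' _).trans (mul_le_mul_of_nonneg_left h2 (norm_nonneg E))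
    have h4 := mul_le_mul_of_nonneg_left h3 hc.le
    linarith
  · intro ε hε
    obtain ⟨η, hη, hηε⟩ : ∃ η > 0, c * (‖E‖ * (η * ‖E‖)) ≤ ε / 2 := by
      refine ⟨ε / (2 * (c * (‖E‖ * ‖E‖) + 1)), by positivity, ?_⟩
      have h : 0 < c * (‖E‖ * ‖E‖) + 1 := by positivity
      have e : c * (‖E‖ * (ε / (2 * (c * (‖E‖ * ‖E‖) + 1)) * ‖E‖))
        = ε / 2 * ((c * (‖E‖ * ‖E‖)) / (c * (‖E‖ * ‖E‖) + 1)) := by field_simp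
      rw [e]
      have : (c * (‖E‖ * ‖E‖)) / (c * (‖E‖ * ‖E‖) + 1) ≤ 1 := by
        rw [div_le_one h]; linarith
      nlinarith
    obtain ⟨δ₁, hδ₁, H1⟩ := c1_semi hg1 ξs (ε / 2) (half_pos hε)
    obtain ⟨δ₂, hδ₂, H2⟩ := hss.2.2 η hη
    refine ⟨min δ₁ (δ₂ / (‖E‖ + 1)), by positivity, fun l hl => ?_⟩
    rw [lt_min_iff, lt_div_iff₀ (by positivity)] at hl
    have hz : E (ξ l) + c⁻¹ • lam - (E ξs + c⁻¹ • lam) = E (ξ l - ξs) := by rw [map_sub]; abel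
    have hz' : E ξs + c⁻¹ • lam - (E (ξ l) + c⁻¹ • lam) = E (ξs - ξ l) := by rw [map_sub]; abel
    have a1 := H1 _ hl.1
    have a2 : ‖p (E (ξ l) + c⁻¹ • lam) + G l (E (ξs - ξ l)) - p (E ξs + c⁻¹ • lam)‖
        ≤ η * (‖E‖ * ‖ξ l - ξs‖) := by
      rw [← hz']
      rcases eq_or_ne (E (ξ l) + c⁻¹ • lam) (E ξs + c⁻¹ • lam) with h | h
      · rw [h]; simp; positivity
      · have h6 := hEn (ξ l - ξs)
        have := H2 _ h (by
          rw [hz]; nlinarith [norm_nonneg (ξ l - ξs), hl.2]) (G l) (hGm l)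
        rw [hz] at this
        exact this.trans (by gcongr)
    have e : gradPsi f c p E x lam (ξ l) + V l (ξs - ξ l)
       = (gradient f (ξ l) + fderiv ℝ (gradient f) (ξ l) (ξs - ξ l) - gradient f ξs)
        - c • E' (p (E (ξ l) + c⁻¹ • lam) + G l (E (ξs - ξ l)) - p (E ξs + c⁻¹ • lam)) := by
      rw [← sub_zero (gradPsi f c p E x lam (ξ l) + V l (ξs - ξ l)), ← hG0, hFdef, hFdef, hVa]
      simp only [map_sub, map_add, map_smul]; module
    rw [e]
    refine (norm_sub_le _ _).trans ?_
    rw [norm_smul, Real.norm_of_nonneg hc.le]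
    have h3 := (hEn' _).trans (mul_le_mul_of_nonneg_left a2 (norm_nonneg E))
    have h4 := mul_le_mul_of_nonneg_left h3 hc.le
    have h5 := mul_le_mul_of_nonneg_right hηε (norm_nonneg (ξ l - ξs))
    linarith
  · intro ε hε
    obtain ⟨η, hη, hηε⟩ : ∃ η > 0, c * (‖E‖ * (η * ‖E‖)) ≤ ε / 2 := by
      refine ⟨ε / (2 * (c * (‖E‖ * ‖E‖) + 1)), by positivity, ?_⟩
      have h : 0 < c * (‖E‖ * ‖E‖) + 1 := by positivity
      have e : c * (‖E‖ * (ε / (2 * (c * (‖E‖ * ‖E‖) + 1)) * ‖E‖))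
        = ε / 2 * ((c * (‖E‖ * ‖E‖)) / (c * (‖E‖ * ‖E‖) + 1)) := by field_simp
      rw [e]
      have : (c * (‖E‖ * ‖E‖)) / (c * (‖E‖ * ‖E‖) + 1) ≤ 1 := by
        rw [div_le_one h]; linarith
      nlinarith
    obtain ⟨δ₁, hδ₁, H1⟩ := c1_unif hg1 ξs (ε / 2) (half_pos hε)
    obtain ⟨δ₂, hδ₂, H2⟩ := dirdiff_unif hlip _ (hss.2.1.self_of_nhds) η hη
    refine ⟨min δ₁ (δ₂ / (‖E‖ + 1)), by positivity, fun v hl t ht => ?_⟩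
    rw [lt_min_iff, lt_div_iff₀ (by positivity)] at hl
    have a1 := H1 v hl.1 t ht
    have h6 := hEn v
    have a2 := (H2 (E v) (by nlinarith [norm_nonneg v, hl.2]) t ht).trans
      (mul_le_mul_of_nonneg_left h6 hη.le)
    have z1 : E (ξs + t • v) + c⁻¹ • lam = E ξs + c⁻¹ • lam + t • E v := by
      simp only [map_add, map_smul]; abel
    have z2 : E (ξs + v) + c⁻¹ • lam = E ξs + c⁻¹ • lam + E v := by
      simp only [map_add]; abel
    have e : gradPsi f c p E x lam (ξs + t • v) - t • gradPsi f c p E x lam (ξs + v)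
       = (gradient f (ξs + t • v) - gradient f ξs - t • (gradient f (ξs + v) - gradient f ξs))
        - c • E' (p (E ξs + c⁻¹ • lam + t • E v) - p (E ξs + c⁻¹ • lam)
          - t • (p (E ξs + c⁻¹ • lam + E v) - p (E ξs + c⁻¹ • lam))) := by
      have : gradPsi f c p E x lam (ξs + t • v) - t • gradPsi f c p E x lam (ξs + v)
        = gradPsi f c p E x lam (ξs + t • v) - gradPsi f c p E x lam ξs
          - t • (gradPsi f c p E x lam (ξs + v) - gradPsi f c p E x lam ξs) := by
        rw [hG0, sub_zero, sub_zero]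
      rw [this, hFdef, hFdef, hFdef, z1, z2]
      simp only [map_sub, map_add, map_smul]; module
    rw [e]
    refine (norm_sub_le _ _).trans ?_
    rw [norm_smul, Real.norm_of_nonneg hc.le]
    have h3 := (hEn' _).trans (mul_le_mul_of_nonneg_left a2 (norm_nonneg E))
    have h4 := mul_le_mul_of_nonneg_left h3 hc.le
    have h5 := mul_le_mul_of_nonneg_right hηε (norm_nonneg v)
    linarith
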